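/- arXiv:1703.08834 — 3 statements merged into one kernel-verified Lean document; each statement's English description precedes it below -/
import Mathlib

section
/- If n = pqr, where p < q < r are primes, then [\overline{pr}] ∪ [\overline{qr}] (the union of the ≈-classes of \overline{pr} and \overline{qr} in ℤ_n) is a minimum separating set of 𝒢̃(ℤ_n), and consequently κ(𝒢(ℤ_n)) = φ(n) + p + q − 1. -/
open SimpleGraph

/-- The power graph of a (multiplicative) group: distinct `x, y` are adjacent
iff one is a power of the other. -/
def powerGraph (G : Type*) [Group G] : SimpleGraph G where
  Adj x y := x ≠ y ∧ (x ∈ Subgroup.zpowers y ∨ y ∈ Subgroup.zpowers x)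
  symm := by
    constructor
    rintro x y ⟨h1, h2⟩
    exact ⟨h1.symm, h2.symm⟩
  loopless := by
    constructor
    rintro x ⟨h1, -⟩
    exact h1 rfl

/-- The power graph of the additive group `ℤ_n`. -/
def powerGraphZ (n : ℕ) : SimpleGraph (ZMod n) where
  Adj x y := x ≠ y ∧ (x ∈ AddSubgroup.zmultiples y ∨ y ∈ AddSubgroup.zmultiples x)
  symm := by
    constructor
    rintro x y ⟨h1, h2⟩
    exact ⟨h1.symm, h2.symm⟩
  loopless := by
    constructor
    rintro x ⟨h1, -⟩
    exact h1 rfl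

/-- Number of connected components of a graph. -/
noncomputable def numComponents {V : Type*} (Γ : SimpleGraph V) : ℕ :=
  Nat.card Γ.ConnectedComponent

/-- `T` is a separating set of `Γ`: deleting `T` increases the number of components. -/
def IsSepSet {V : Type*} (Γ : SimpleGraph V) (T : Set V) : Prop :=
  numComponents Γ < numComponents (Γ.induce Tᶜ)

/-- A separating set is minimal if no nonempty proper subset of it is separating. -/
def IsMinimalSepSet {V : Type*} (Γ : SimpleGraph V) (T : Set V) : Prop :=
  IsSepSet Γ T ∧ ∀ S : Set V, S ⊆ T → S ≠ T → S.Nonempty → ¬ IsSepSet Γ S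

/-- A separating set of least cardinality. -/
def IsMinimumSepSet {V : Type*} (Γ : SimpleGraph V) (T : Set V) : Prop :=
  IsSepSet Γ T ∧ ∀ S : Set V, IsSepSet Γ S → T.ncard ≤ S.ncard

/-- Vertex connectivity: the least number of vertices whose removal leaves a
disconnected or one-vertex graph. -/
noncomputable def kappa {V : Type*} (Γ : SimpleGraph V) : ℕ :=
  sInf {k | ∃ S : Set V, S.ncard = k ∧
    (¬ (Γ.induce Sᶜ).Preconnected ∨ (Sᶜ : Set V).ncard = 1)}

/-- `𝒮(ℤ_n)`: the identity together with the generators of `ℤ_n`. -/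
def genSet (n : ℕ) : Set (ZMod n) :=
  {x | AddSubgroup.zmultiples x = ⊤} ∪ {0}

/-- `ℤ̃_n = ℤ_n − 𝒮(ℤ_n)`. -/
def tildeVerts (n : ℕ) : Set (ZMod n) := (genSet n)ᶜ

/-- `𝒢̃(ℤ_n)`: the subgraph of the power graph induced on `ℤ̃_n`. -/
def tildeGraph (n : ℕ) : SimpleGraph (tildeVerts n) :=
  (powerGraphZ n).induce (tildeVerts n)

/-- The `≈`-class of `x`: elements generating the same cyclic subgroup. -/
def simClass {G : Type*} [Group G] (x : G) : Set G :=
  {y | Subgroup.zpowers y = Subgroup.zpowers x}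

/-- The `≈`-class in `ℤ_n`. -/
def simClassZ {n : ℕ} (x : ZMod n) : Set (ZMod n) :=
  {y | AddSubgroup.zmultiples y = AddSubgroup.zmultiples x}

/-- Neighbourhood of a set of vertices: vertices adjacent to some element of `A`,
excluding `A` itself. -/
def setNbhd {V : Type*} (Γ : SimpleGraph V) (A : Set V) : Set V :=
  (⋃ a ∈ A, Γ.neighborSet a) \ A

/-- The proper power graph: the power graph with the identity removed. -/
def properPowerGraph (G : Type*) [Group G] : SimpleGraph ({g : G | g ≠ 1}) :=
  (powerGraph G).induce {g : G | g ≠ 1}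

def dd (n : ℕ) (x : ZMod n) : ℕ := n.gcd x.val

lemma mem_zm {n : ℕ} [NeZero n] (x y : ZMod n) :
    x ∈ AddSubgroup.zmultiples y ↔ dd n y ∣ dd n x := by
  rw [AddSubgroup.mem_zmultiples_iff]
  constructor
  · rintro ⟨k, rfl⟩
    refine Nat.dvd_gcd (Nat.gcd_dvd_left _ _) ?_
    have h1 : ((dd n y : ℕ) : ℤ) ∣ (n : ℤ) := by exact_mod_cast Nat.gcd_dvd_left _ _
    have h2 : ((dd n y : ℕ) : ℤ) ∣ (y.val : ℤ) := by exact_mod_cast Nat.gcd_dvd_right _ _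
    have h3 : (((k • y).val : ℤ) : ZMod n) = ((k * y.val : ℤ) : ZMod n) := by
      push_cast
      rw [ZMod.natCast_zmod_val, ZMod.natCast_zmod_val]; simp
    rw [ZMod.intCast_eq_intCast_iff_dvd_sub] at h3
    have h4 := (h1.trans h3)
    have h5 : ((dd n y : ℕ) : ℤ) ∣ ((k • y).val : ℤ) := by
      have := (Dvd.dvd.mul_left h2 k).sub h4
      simpa using this
    exact_mod_cast h5
  · intro h
    obtain ⟨c, hc⟩ := h.trans (Nat.gcd_dvd_right n x.val)
    have hb := Nat.gcd_eq_gcd_ab n y.val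
    refine ⟨c * Nat.gcdB n y.val, ?_⟩
    have e : ((dd n y : ℕ) : ZMod n) = y * (Nat.gcdB n y.val : ZMod n) := by
      have := congrArg (Int.cast : ℤ → ZMod n) hb
      push_cast at this
      rw [ZMod.natCast_zmod_val, ZMod.natCast_self] at this
      simpa [dd] using this
    have hx : (x.val : ZMod n) = x := ZMod.natCast_zmod_val x
    rw [← hx, hc]
    push_cast
    rw [e]
    simp only [zsmul_eq_mul]
    push_cast
    ring

lemma zm_eq {n : ℕ} [NeZero n] (x y : ZMod n) :
    AddSubgroup.zmultiples x = AddSubgroup.zmultiples y ↔ dd n x = dd n y := by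
  constructor
  · intro h
    apply Nat.dvd_antisymm
    · rw [← mem_zm, h]; exact AddSubgroup.mem_zmultiples y
    · rw [← mem_zm, ← h]; exact AddSubgroup.mem_zmultiples x
  · intro h
    apply le_antisymm
    · rw [AddSubgroup.zmultiples_le, mem_zm, h]
    · rw [AddSubgroup.zmultiples_le, mem_zm, h]

lemma dd_cast {n : ℕ} {d : ℕ} (h : d ∣ n) : dd n (d : ZMod n) = d := by
  unfold dd
  rw [ZMod.val_natCast, Nat.gcd_comm, ← Nat.gcd_rec, Nat.gcd_eq_right h]

lemma zm_top {n : ℕ} [NeZero n] (x : ZMod n) :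
    AddSubgroup.zmultiples x = ⊤ ↔ dd n x = 1 := by
  have h1 : dd n (1 : ZMod n) = 1 := by
    have := dd_cast (one_dvd n); simpa using this
  rw [← h1, ← zm_eq]
  have : AddSubgroup.zmultiples (1 : ZMod n) = ⊤ := by
    rw [AddSubgroup.eq_top_iff']
    intro y; rw [mem_zm, h1]; exact one_dvd _
  rw [this]

lemma dd_zero {n : ℕ} [NeZero n] (x : ZMod n) : x = 0 ↔ dd n x = n := by
  unfold dd
  rw [Nat.gcd_eq_left_iff_dvd]
  constructor
  · rintro rfl; simp
  · intro h
    have := Nat.eq_zero_of_dvd_of_lt h (ZMod.val_lt x)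
    exact (ZMod.val_eq_zero x).1 this

lemma gen_iff {n : ℕ} [NeZero n] (x : ZMod n) : x ∈ genSet n ↔ dd n x = 1 ∨ dd n x = n := by
  unfold genSet
  rw [Set.mem_union, Set.mem_setOf_eq, zm_top, Set.mem_singleton_iff, dd_zero]

def fib (n d : ℕ) : Set (ZMod n) := {x | dd n x = d}

lemma fib_card {n d : ℕ} [NeZero n] (h : d ∣ n) : (fib n d).ncard = Nat.totient (n / d) := by
  rw [Nat.totient_div_of_dvd h, ← Set.ncard_coe_finset]
  have : ((((Finset.range n).filter (fun k => n.gcd k = d) : Finset ℕ)) : Set ℕ)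
      = ZMod.val '' (fib n d) := by
    ext k
    simp only [Finset.coe_filter, Finset.mem_range, Set.mem_setOf_eq, Set.mem_image, fib, dd]
    constructor
    · rintro ⟨h1, h2⟩
      exact ⟨k, by rw [ZMod.val_natCast_of_lt h1]; exact h2, ZMod.val_natCast_of_lt h1⟩
    · rintro ⟨x, hx, rfl⟩
      exact ⟨ZMod.val_lt x, hx⟩
  rw [this, Set.ncard_image_of_injective _ (ZMod.val_injective n)]

lemma fib_disj {n d e : ℕ} (h : d ≠ e) : Disjoint (fib n d) (fib n e) := by
  rw [Set.disjoint_left]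
  intro x hx hy
  exact h (hx.symm.trans hy)

lemma cyc6 {V : Type*} (G : SimpleGraph V) (f : V → Fin 6)
    (hadj : ∀ x y, x ≠ y → (f x = f y ∨ f y = f x + 1) → G.Adj x y)
    (hm : ∀ i j, i ≠ j → (∃ x, f x = i) ∨ (∃ x, f x = j)) : G.Preconnected := by
  have hr : ∀ x y, (f x = f y ∨ f y = f x + 1) → G.Reachable x y := by
    intro x y h
    by_cases e : x = y
    · rw [e]
    · exact (hadj x y e h).reachable
  have : ∃ c, ∀ i, i ≠ c → ∃ x, f x = i := by
    by_contra! H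
    obtain ⟨a, -, ha⟩ := H 0
    obtain ⟨b, hb, hb'⟩ := H a
    rcases hm b a hb with ⟨x, hx⟩ | ⟨x, hx⟩
    · exact hb' x hx
    · exact ha x hx
  obtain ⟨c, hc⟩ := this
  obtain ⟨v1, h1⟩ := hc (c + 1) (by clear * -; revert c; decide)
  obtain ⟨v2, h2⟩ := hc (c + 2) (by clear * -; revert c; decide)
  obtain ⟨v3, h3⟩ := hc (c + 3) (by clear * -; revert c; decide)
  obtain ⟨v4, h4⟩ := hc (c + 4) (by clear * -; revert c; decide)
  obtain ⟨v5, h5⟩ := hc (c + 5) (by clear * -; revert c; decide)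
  have r12 : G.Reachable v1 v2 := hr _ _ (Or.inr (by rw [h1, h2, add_assoc]; rfl))
  have r23 : G.Reachable v2 v3 := hr _ _ (Or.inr (by rw [h2, h3, add_assoc]; rfl))
  have r34 : G.Reachable v3 v4 := hr _ _ (Or.inr (by rw [h3, h4, add_assoc]; rfl))
  have r45 : G.Reachable v4 v5 := hr _ _ (Or.inr (by rw [h4, h5, add_assoc]; rfl))
  have key : ∀ x, G.Reachable x v1 := by
    intro x
    have hx : f x = c ∨ f x = c + 1 ∨ f x = c + 2 ∨ f x = c + 3 ∨ f x = c + 4 ∨ f x = c + 5 := by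
      generalize f x = a
      clear * -
      revert a c; decide
    rcases hx with h | h | h | h | h | h
    · exact hr _ _ (Or.inr (by rw [h1, h]))
    · exact hr _ _ (Or.inl (by rw [h1, h]))
    · exact (hr x v2 (Or.inl (by rw [h2, h]))).trans r12.symm
    · exact ((hr x v3 (Or.inl (by rw [h3, h]))).trans r23.symm).trans r12.symm
    · exact (((hr x v4 (Or.inl (by rw [h4, h]))).trans r34.symm).trans r23.symm).trans r12.symm
    · exact ((((hr x v5 (Or.inl (by rw [h5, h]))).trans r45.symm).trans r34.symm).trans
        r23.symm).trans r12.symm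
  intro x y
  exact (key x).trans (key y).symm

lemma dvd_cases {p q r d : ℕ} (hp : p.Prime) (hq : q.Prime) (hr : r.Prime)
    (h : d ∣ p * q * r) : d = 1 ∨ d = p * q * r ∨ d = p ∨ d = p * q ∨ d = q ∨ d = q * r ∨
      d = r ∨ d = p * r := by
  obtain ⟨a, c, ha, hc, rfl⟩ := (Nat.dvd_mul).1 h
  obtain ⟨a, b, ha', hb, rfl⟩ := (Nat.dvd_mul).1 ha
  rcases (Nat.dvd_prime hp).1 ha' with rfl | rfl <;>
  rcases (Nat.dvd_prime hq).1 hb with rfl | rfl <;>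
  rcases (Nat.dvd_prime hr).1 hc with rfl | rfl <;> simp

def ee (p q r : ℕ) : Fin 6 → ℕ := ![p, p * q, q, q * r, r, p * r]

section
variable {p q r : ℕ}

lemma ee_dvd (i : Fin 6) : ee p q r i ∣ p * q * r := by
  fin_cases i <;> simp only [ee] <;> simp
  · exact ⟨q * r, by ring⟩
  · exact ⟨p * r, by ring⟩
  · exact ⟨p, by ring⟩
  · exact ⟨q, by ring⟩

lemma ee_adj (i : Fin 6) : ee p q r i ∣ ee p q r (i + 1) ∨ ee p q r (i + 1) ∣ ee p q r i := by
  fin_cases i <;> simp [ee]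

lemma ee_tot (hp : p.Prime) (hq : q.Prime) (hr : r.Prime)
    (hpq : p < q) (hqr : q < r) (i : Fin 6) :
    p - 1 ≤ Nat.totient (p * q * r / ee p q r i) ∧
    (i ≠ 3 → q - 1 ≤ Nat.totient (p * q * r / ee p q r i)) := by
  have := hp.two_le
  have c1 : Nat.Coprime p q := (Nat.coprime_primes hp hq).2 (by omega)
  have c2 : Nat.Coprime p r := (Nat.coprime_primes hp hr).2 (by omega)
  have c3 : Nat.Coprime q r := (Nat.coprime_primes hq hr).2 (by omega)
  have e0 : p * q * r / p = q * r := Nat.div_eq_of_eq_mul_left hp.pos (by ring)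
  have e1 : p * q * r / (p * q) = r :=
    Nat.div_eq_of_eq_mul_left (Nat.mul_pos hp.pos hq.pos) (by ring)
  have e2 : p * q * r / q = p * r := Nat.div_eq_of_eq_mul_left hq.pos (by ring)
  have e3 : p * q * r / (q * r) = p :=
    Nat.div_eq_of_eq_mul_left (Nat.mul_pos hq.pos hr.pos) (by ring)
  have e4 : p * q * r / r = p * q := Nat.div_eq_of_eq_mul_left hr.pos (by ring)
  have e5 : p * q * r / (p * r) = q :=
    Nat.div_eq_of_eq_mul_left (Nat.mul_pos hp.pos hr.pos) (by ring)
  have tp := Nat.totient_prime hp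
  have tq := Nat.totient_prime hq
  have tr := Nat.totient_prime hr
  have k1 : q - 1 ≤ (q - 1) * (r - 1) := Nat.le_mul_of_pos_right _ (by omega)
  have k2 : r - 1 ≤ (p - 1) * (r - 1) := Nat.le_mul_of_pos_left _ (by omega)
  have k3 : q - 1 ≤ (p - 1) * (q - 1) := Nat.le_mul_of_pos_left _ (by omega)
  fin_cases i <;> simp [ee, e0, e1, e2, e3, e4, e5, Nat.totient_mul c1, Nat.totient_mul c2, Nat.totient_mul c3, tp, tq, tr] <;>
    omega

lemma ee_inj (hp : p.Prime) (hq : q.Prime) (hr : r.Prime)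
    (hpq : p < q) (hqr : q < r) : Function.Injective (ee p q r) := by
  have := hp.two_le
  have h1 : r < q * r := by nlinarith
  have h2 : r < p * r := by nlinarith
  have h3 : q < p * q := by nlinarith
  have h4 : p * r < q * r := by nlinarith
  have h5 : p * q < p * r := by nlinarith
  have h6 : p * q ≠ r := by
    rintro rfl
    rcases (Nat.dvd_prime hr).1 (Dvd.intro _ rfl : p ∣ p * q) with h | h <;> omega
  intro i j h
  fin_cases i <;> fin_cases j <;> simp [ee] at h ⊢ <;> omega

lemma tilde_iff (hp : p.Prime) (hq : q.Prime) (hr : r.Prime)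
    [NeZero (p * q * r)] (hpq : p < q) (hqr : q < r) (x : ZMod (p * q * r)) :
    x ∈ tildeVerts (p * q * r) ↔ ∃ i, dd (p * q * r) x = ee p q r i := by
  have h0 : dd (p * q * r) x ∣ p * q * r := Nat.gcd_dvd_left _ _
  have := hp.two_le
  unfold tildeVerts
  rw [Set.mem_compl_iff, gen_iff]
  constructor
  · intro h
    push Not at h
    rcases dvd_cases hp hq hr h0 with h' | h' | h' | h' | h' | h' | h' | h'
    · exact absurd h' h.1
    · exact absurd h' h.2
    · exact ⟨0, h'⟩
    · exact ⟨1, h'⟩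
    · exact ⟨2, h'⟩
    · exact ⟨3, h'⟩
    · exact ⟨4, h'⟩
    · exact ⟨5, h'⟩
  · rintro ⟨i, hi⟩
    rw [hi]
    have h1 : r < q * r := by nlinarith
    have h2 : r < p * r := by nlinarith
    have h3 : q < p * q := by nlinarith
    have h4 : p * r < q * r := by nlinarith
    have h5 : p * q < p * r := by nlinarith
    have h6 : q * r < p * q * r := by nlinarith
    fin_cases i <;> simp only [ee] <;> simp <;> omega

lemma lemA (hp : p.Prime) (hq : q.Prime) (hr : r.Prime)
    [NeZero (p * q * r)] (hpq : p < q) (hqr : q < r) {V : Type*} (G : SimpleGraph V)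
    (g : V → ZMod (p * q * r)) (hg : Function.Injective g)
    (hgt : ∀ v, g v ∈ tildeVerts (p * q * r))
    (hG : ∀ x y, (powerGraphZ (p * q * r)).Adj (g x) (g y) → G.Adj x y)
    (hn : ¬ G.Preconnected) :
    p + q - 2 ≤ (tildeVerts (p * q * r) \ Set.range g).ncard := by
  have hf : ∀ v, ∃ i, dd (p * q * r) (g v) = ee p q r i := fun v =>
    (tilde_iff hp hq hr hpq hqr _).1 (hgt v)
  choose f hf using hf
  have h2 : ∃ i j, i ≠ j ∧ (¬ ∃ x, f x = i) ∧ (¬ ∃ x, f x = j) := by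
    by_contra! H
    apply hn
    apply cyc6 G f
    · intro x y hxy h
      apply hG
      refine ⟨fun h => hxy (hg h), ?_⟩
      rw [mem_zm, mem_zm, hf, hf]
      rcases h with h | h
      · rw [h]; simp
      · rw [h]; exact (ee_adj (f x)).symm
    · intro i j hij
      by_cases h : ∃ x, f x = i
      · exact Or.inl h
      · right; push Not at h; exact H i j hij h
  obtain ⟨i, j, hij, hi, hj⟩ := h2
  have inj := ee_inj hp hq hr hpq hqr
  have sub : ∀ i, (¬ ∃ x, f x = i) →
      fib (p * q * r) (ee p q r i) ⊆ tildeVerts (p * q * r) \ Set.range g := by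
    intro i hi x hx
    refine ⟨(tilde_iff hp hq hr hpq hqr _).2 ⟨i, hx⟩, ?_⟩
    rintro ⟨v, rfl⟩
    exact hi ⟨v, inj ((hf v).symm.trans hx)⟩
  have hc := Set.ncard_le_ncard (Set.union_subset (sub i hi) (sub j hj)) (Set.toFinite _)
  rw [Set.ncard_union_eq (fib_disj (inj.ne hij)) (Set.toFinite _) (Set.toFinite _),
    fib_card (ee_dvd i), fib_card (ee_dvd j)] at hc
  have ti := ee_tot hp hq hr hpq hqr i
  have tj := ee_tot hp hq hr hpq hqr j
  by_cases h3 : i = 3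
  · have := tj.2 (by rintro rfl; exact hij h3)
    omega
  · have := ti.2 h3
    omega

def TT (p q r : ℕ) : Set (ZMod (p * q * r)) :=
  fib (p * q * r) (p * r) ∪ fib (p * q * r) (q * r)

lemma TT_card (hp : p.Prime) (hq : q.Prime) (hr : r.Prime)
    [NeZero (p * q * r)] (hpq : p < q) : (TT p q r).ncard = p + q - 2 := by
  have hne : p * r ≠ q * r := by
    intro h; have := Nat.eq_of_mul_eq_mul_right hr.pos h; omega
  have e3 : p * q * r / (q * r) = p :=
    Nat.div_eq_of_eq_mul_left (Nat.mul_pos hq.pos hr.pos) (by ring)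
  have e5 : p * q * r / (p * r) = q :=
    Nat.div_eq_of_eq_mul_left (Nat.mul_pos hp.pos hr.pos) (by ring)
  have := hp.two_le
  unfold TT
  rw [Set.ncard_union_eq (fib_disj hne) (Set.toFinite _) (Set.toFinite _),
    fib_card (d := p * r) (ee_dvd 5), fib_card (d := q * r) (ee_dvd 3), e3, e5,
    Nat.totient_prime hp, Nat.totient_prime hq]
  omega

lemma TT_sub (hp : p.Prime) (hq : q.Prime) (hr : r.Prime)
    [NeZero (p * q * r)] (hpq : p < q) (hqr : q < r) : TT p q r ⊆ tildeVerts (p * q * r) := by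
  rintro x (h | h)
  · exact (tilde_iff hp hq hr hpq hqr _).2 ⟨5, h⟩
  · exact (tilde_iff hp hq hr hpq hqr _).2 ⟨3, h⟩

lemma lemB (hp : p.Prime) (hq : q.Prime) (hr : r.Prime)
    [NeZero (p * q * r)] (hpq : p < q) (hqr : q < r) {V : Type*} (G : SimpleGraph V)
    (g : V → ZMod (p * q * r))
    (hgt : Set.range g = tildeVerts (p * q * r) \ TT p q r)
    (hG : ∀ x y, G.Adj x y → (powerGraphZ (p * q * r)).Adj (g x) (g y)) :
    ¬ G.Preconnected := by
  intro hc
  have inj := ee_inj hp hq hr hpq hqr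
  have ex : ∀ i : Fin 6, i ≠ 5 → i ≠ 3 → ∃ v, dd (p * q * r) (g v) = ee p q r i := by
    intro i h5 h3
    have hd := dd_cast (ee_dvd (p := p) (q := q) (r := r) i)
    have : ((ee p q r i : ℕ) : ZMod (p * q * r)) ∈ Set.range g := by
      rw [hgt]
      refine ⟨(tilde_iff hp hq hr hpq hqr _).2 ⟨i, hd⟩, ?_⟩
      rintro (h | h)
      · exact h5 (inj (hd.symm.trans h))
      · exact h3 (inj (hd.symm.trans h))
    obtain ⟨v, hv⟩ := this
    exact ⟨v, by rw [hv, hd]⟩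
  obtain ⟨a, ha⟩ := ex 4 (by decide) (by decide)
  obtain ⟨b, hb⟩ := ex 0 (by decide) (by decide)
  have n1 : ¬ p ∣ r := fun h => by
    have := (Nat.prime_dvd_prime_iff_eq hp hr).1 h; omega
  have n2 : ¬ q ∣ r := fun h => by
    have := (Nat.prime_dvd_prime_iff_eq hq hr).1 h; omega
  have n3 : ¬ r ∣ p := fun h => by
    have := (Nat.prime_dvd_prime_iff_eq hr hp).1 h; omega
  have n4 : ¬ r ∣ q := fun h => by
    have := (Nat.prime_dvd_prime_iff_eq hr hq).1 h; omega
  have step : ∀ x y, G.Adj x y → dd (p * q * r) (g x) = r → dd (p * q * r) (g y) = r := by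
    intro x y hxy hx
    have had := (hG x y hxy).2
    rw [mem_zm, mem_zm, hx] at had
    have hy : g y ∈ tildeVerts (p * q * r) \ TT p q r := hgt ▸ Set.mem_range_self y
    obtain ⟨i, hi⟩ := (tilde_iff hp hq hr hpq hqr _).1 hy.1
    have hy2 := hy.2
    rw [hi] at had
    fin_cases i
    · rcases had with h | h
      · exact absurd h n1
      · exact absurd h n3
    · rcases had with h | h
      · exact absurd ((Dvd.intro _ rfl : p ∣ p * q).trans h) n1
      · rcases hr.dvd_mul.1 h with h | h
        · exact absurd h n3
        · exact absurd h n4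
    · rcases had with h | h
      · exact absurd h n2
      · exact absurd h n4
    · exact absurd (Or.inr hi) hy2
    · exact hi
    · exact absurd (Or.inl hi) hy2
  have walk : ∀ x y, G.Walk x y → dd (p * q * r) (g x) = r → dd (p * q * r) (g y) = r := by
    intro x y w
    induction w with
    | nil => exact id
    | cons h _ ih => exact fun hx => ih (step _ _ h hx)
  obtain ⟨w⟩ := hc a b
  have := walk a b w ha
  rw [hb] at this
  have : p = r := this
  omega
end

lemma num_le {V : Type*} (G : SimpleGraph V) (h : G.Preconnected) : numComponents G ≤ 1 := by
  unfold numComponents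
  have := h.subsingleton_connectedComponent
  exact Finite.card_le_one_iff_subsingleton.2 this

lemma num_gt {V : Type*} [Finite V] (G : SimpleGraph V) (h : ¬ G.Preconnected) :
    1 < numComponents G := by
  by_contra hc
  unfold numComponents at hc
  push Not at hc
  have := Finite.card_le_one_iff_subsingleton.1 hc
  apply h
  intro x y
  exact SimpleGraph.ConnectedComponent.exact (Subsingleton.elim _ _)

lemma num_pos {V : Type*} [Finite V] [Nonempty V] (G : SimpleGraph V) : 1 ≤ numComponents G := by
  unfold numComponents
  have : Nonempty G.ConnectedComponent := ⟨G.connectedComponentMk (Classical.arbitrary V)⟩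
  exact Nat.card_pos

/-- If `n = pqr` with primes `p < q < r`, then
`[\overline{pr}] ∪ [\overline{qr}]` is a minimum separating set of `𝒢̃(ℤ_n)`, and
`κ(𝒢(ℤ_n)) = φ(n) + p + q − 1`. -/
theorem stmt16 (n p q r : ℕ) (hp : p.Prime) (hq : q.Prime) (hr : r.Prime)
    (hpq : p < q) (hqr : q < r) (hn : n = p * q * r) :
    IsMinimumSepSet (tildeGraph n)
      (Subtype.val ⁻¹'
        (simClassZ (((p * r : ℕ) : ZMod n)) ∪ simClassZ (((q * r : ℕ) : ZMod n)))) ∧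
    kappa (powerGraphZ n) = Nat.totient n + p + q - 1 := by
  subst hn
  haveI : NeZero (p * q * r) := ⟨(Nat.mul_pos (Nat.mul_pos hp.pos hq.pos) hr.pos).ne'⟩
  have h2p := hp.two_le
  have hT : simClassZ (((p * r : ℕ) : ZMod (p * q * r))) ∪
      simClassZ (((q * r : ℕ) : ZMod (p * q * r))) = TT p q r := by
    have h1 : dd (p * q * r) ((p * r : ℕ) : ZMod (p * q * r)) = p * r :=
      dd_cast (ee_dvd 5 : p * r ∣ _)
    have h2 : dd (p * q * r) ((q * r : ℕ) : ZMod (p * q * r)) = q * r :=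
      dd_cast (ee_dvd 3 : q * r ∣ _)
    ext x
    simp only [simClassZ, TT, fib, Set.mem_union, Set.mem_setOf_eq, zm_eq, h1, h2]
  rw [hT]
  have hTc := TT_card hp hq hr hpq
  have hTs := TT_sub hp hq hr hpq hqr
  have hTc' : (Subtype.val ⁻¹' TT p q r : Set (tildeVerts (p * q * r))).ncard = p + q - 2 := by
    rw [← hTc, ← Set.ncard_image_of_injective _ Subtype.val_injective,
      Subtype.image_preimage_coe, Set.inter_eq_right.2 hTs]
  have hgen : (genSet (p * q * r)).ncard = Nat.totient (p * q * r) + 1 := by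
    have : genSet (p * q * r) = fib (p * q * r) 1 ∪ fib (p * q * r) (p * q * r) := by
      ext x; rw [gen_iff]; rfl
    have hne : 1 ≠ p * q * r := by nlinarith [hq.two_le, hr.two_le, Nat.mul_le_mul h2p hq.two_le]
    rw [this, Set.ncard_union_eq (fib_disj hne) (Set.toFinite _) (Set.toFinite _),
      fib_card (one_dvd _), fib_card dvd_rfl, Nat.div_self (NeZero.pos _)]
    simp
  refine ⟨⟨?_, ?_⟩, ?_⟩
  · refine lt_of_le_of_lt (num_le _ ?_) (num_gt _ ?_)
    · by_contra hc
      have := lemA hp hq hr hpq hqr (tildeGraph (p * q * r)) Subtype.val Subtype.val_injective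
        (fun v => v.2) (fun x y h => h) hc
      rw [Subtype.range_coe, Set.diff_self, Set.ncard_empty] at this
      omega
    · apply lemB hp hq hr hpq hqr _ (fun v => v.1.1)
      · ext x
        constructor
        · rintro ⟨v, rfl⟩
          exact ⟨v.1.2, v.2⟩
        · rintro ⟨h1, h2⟩
          exact ⟨⟨⟨x, h1⟩, h2⟩, rfl⟩
      · exact fun x y h => h
  · intro S hS
    rw [hTc']
    have hne : Nonempty (tildeVerts (p * q * r)) :=
      ⟨⟨_, (tilde_iff hp hq hr hpq hqr _).2 ⟨0, dd_cast (ee_dvd 0)⟩⟩⟩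
    have h1 : ¬ ((tildeGraph (p * q * r)).induce Sᶜ).Preconnected := by
      intro hc
      have := num_le _ hc
      have h3 := num_pos (tildeGraph (p * q * r))
      unfold IsSepSet at hS
      omega
    refine (lemA hp hq hr hpq hqr _ (fun v => v.1.1)
      (Subtype.val_injective.comp Subtype.val_injective) (fun v => v.1.2) (fun x y h => h) h1).trans ?_
    rw [← Set.ncard_image_of_injective S Subtype.val_injective]
    apply Set.ncard_le_ncard _ (Set.toFinite _)
    rintro x ⟨hx1, hx2⟩
    refine ⟨⟨x, hx1⟩, ?_, rfl⟩
    by_contra h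
    exact hx2 ⟨⟨⟨x, hx1⟩, h⟩, rfl⟩
  · unfold kappa
    have hmem : Nat.totient (p * q * r) + p + q - 1 ∈ {k | ∃ S : Set (ZMod (p * q * r)),
        S.ncard = k ∧ (¬ ((powerGraphZ (p * q * r)).induce Sᶜ).Preconnected ∨
          (Sᶜ : Set (ZMod (p * q * r))).ncard = 1)} := by
      refine ⟨genSet (p * q * r) ∪ TT p q r, ?_, Or.inl ?_⟩
      · have hd : Disjoint (genSet (p * q * r)) (TT p q r) :=
          (Set.subset_compl_iff_disjoint_left).1 hTs
        rw [Set.ncard_union_eq hd (Set.toFinite _) (Set.toFinite _), hgen, hTc]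
        omega
      · apply lemB hp hq hr hpq hqr _ Subtype.val
        · rw [Subtype.range_coe, Set.compl_union, tildeVerts, Set.diff_eq]
        · exact fun x y h => h
    apply le_antisymm (Nat.sInf_le hmem)
    refine le_csInf ⟨_, hmem⟩ ?_
    rintro k ⟨S, rfl, h | h⟩
    · have hsub : genSet (p * q * r) ⊆ S := by
        intro x hx
        by_contra hxS
        apply h
        have key : ∀ y : (Sᶜ : Set (ZMod (p * q * r))),
            ((powerGraphZ (p * q * r)).induce Sᶜ).Reachable y ⟨x, hxS⟩ := by
          intro y
          by_cases e : y = ⟨x, hxS⟩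
          · rw [e]
          · apply SimpleGraph.Adj.reachable
            refine ⟨fun h => e (Subtype.ext h), ?_⟩
            change y.1 ∈ AddSubgroup.zmultiples x ∨ x ∈ AddSubgroup.zmultiples y.1
            rw [mem_zm, mem_zm]
            rcases (gen_iff x).1 hx with h | h
            · left; rw [h]; exact one_dvd _
            · right; rw [h]; exact Nat.gcd_dvd_left _ _
        exact fun a b => (key a).trans (key b).symm
      have h3 := lemA hp hq hr hpq hqr _
        (Subtype.val : (Sᶜ : Set _) → ZMod (p * q * r)) Subtype.val_injective
        (fun v hv => v.2 (hsub hv)) (fun x y h => h) h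
      have h4 : tildeVerts (p * q * r) \ Set.range (Subtype.val : (Sᶜ : Set _) → ZMod (p * q * r))
          = S \ genSet (p * q * r) := by
        rw [Subtype.range_coe]
        ext x
        simp [tildeVerts, and_comm]
      rw [h4] at h3
      have := Set.ncard_sdiff_add_ncard_of_subset hsub (Set.toFinite _)
      omega
    · have h3 := Set.ncard_add_ncard_compl S
      rw [h, Nat.card_zmod] at h3
      have c1 : Nat.Coprime p q := (Nat.coprime_primes hp hq).2 (by omega)
      have c2 : Nat.Coprime p r := (Nat.coprime_primes hp hr).2 (by omega)
      have c3 : Nat.Coprime q r := (Nat.coprime_primes hq hr).2 (by omega)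
      have ht : Nat.totient (p * q * r) = (p - 1) * (q - 1) * (r - 1) := by
        rw [Nat.totient_mul (Nat.Coprime.mul_left c2 c3), Nat.totient_mul c1,
          Nat.totient_prime hp, Nat.totient_prime hq, Nat.totient_prime hr]
      have hk : (p - 1) * (q - 1) * (r - 1) + p + q ≤ p * q * r := by
        obtain ⟨a, rfl⟩ : ∃ a, p = a + 1 := ⟨p - 1, by omega⟩
        obtain ⟨b, rfl⟩ : ∃ b, q = b + 1 := ⟨q - 1, by omega⟩
        obtain ⟨c, rfl⟩ : ∃ c, r = c + 1 := ⟨r - 1, by omega⟩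
        simp only [Nat.add_sub_cancel]
        have ha : 1 ≤ a := by omega
        have hb : 1 ≤ b := by omega
        have hc : 1 ≤ c := by omega
        have i1 : 1 ≤ a * b := Nat.mul_pos ha hb
        have i2 : 1 ≤ a * c := Nat.mul_pos ha hc
        nlinarith
      omega
end

section
/- Let p be a prime and G a nontrivial finite p-group (a finite group whose order is a power of p). Then every connected component of the proper power graph 𝒢*(G) contains exactly p − 1 elements of order p. -/
open SimpleGraph

theorem aux_gen {G : Type*} [Group G] [Finite G] {p : ℕ} (hp : p.Prime) {y w z : G}
    (hw : w ∈ Subgroup.zpowers y) (hz : z ∈ Subgroup.zpowers y)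
    (ow : orderOf w = p) (oz : orderOf z = p) : z ∈ Subgroup.zpowers w := by
  have hd : p ∣ orderOf y := by
    rw [← ow]; exact orderOf_dvd_of_mem_zpowers hw
  obtain ⟨k, hk⟩ := hd
  have hpos := orderOf_pos y
  have key : ∀ u : G, u ∈ Subgroup.zpowers y → orderOf u = p →
      u ∈ Subgroup.zpowers (y ^ k) := by
    intro u hu ou
    obtain ⟨a, rfl⟩ := Subgroup.mem_zpowers_iff.1 hu
    have h1 : (y ^ a) ^ p = 1 := by rw [← ou]; exact pow_orderOf_eq_one _
    rw [← zpow_natCast, ← zpow_mul, ← orderOf_dvd_iff_zpow_eq_one, hk, mul_comm a] at h1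
    push_cast at h1
    have h2 : (k : ℤ) ∣ a := Int.dvd_of_mul_dvd_mul_left (by exact_mod_cast hp.ne_zero) h1
    obtain ⟨b, rfl⟩ := h2
    rw [Subgroup.mem_zpowers_iff]
    exact ⟨b, by rw [zpow_mul, zpow_natCast]⟩
  have ok : orderOf (y ^ k) = p := by
    have hk0 : k ≠ 0 := by rintro rfl; rw [mul_zero] at hk; omega
    rw [orderOf_pow_of_dvd hk0 (by rw [hk]; exact dvd_mul_left _ _), hk]
    exact Nat.mul_div_cancel _ (Nat.pos_of_ne_zero hk0)
  have e : Subgroup.zpowers w = Subgroup.zpowers (y ^ k) := by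
    apply Subgroup.eq_of_le_of_card_ge
    · rw [Subgroup.zpowers_le]; exact key w hw ow
    · rw [Nat.card_zpowers, Nat.card_zpowers, ow, ok]
  rw [e]; exact key z hz oz

theorem aux_ex {G : Type*} [Group G] [Finite G] {p : ℕ} (hp : p.Prime)
    (hG : ∃ m : ℕ, Nat.card G = p ^ m) {x : G} (hx : x ≠ 1) :
    ∃ w ∈ Subgroup.zpowers x, orderOf w = p := by
  obtain ⟨m, hm⟩ := hG
  have h1 : orderOf x ∣ p ^ m := hm ▸ orderOf_dvd_natCard x
  obtain ⟨j, -, hj⟩ := (Nat.dvd_prime_pow hp).1 h1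
  have hj0 : j ≠ 0 := by
    rintro rfl
    rw [pow_zero, orderOf_eq_one_iff] at hj
    exact hx hj
  refine ⟨x ^ (orderOf x / p), Subgroup.npow_mem_zpowers _ _, ?_⟩
  exact orderOf_pow_orderOf_div (orderOf_pos x).ne' (hj ▸ dvd_pow_self p hj0)

theorem aux_reach {G : Type*} [Group G] [Finite G] {p : ℕ} (hp : p.Prime)
    (hG : ∃ m : ℕ, Nat.card G = p ^ m) {z : G} (oz : orderOf z = p)
    {x y : {g : G | g ≠ 1}} (h : (properPowerGraph G).Reachable x y)
    (hz : z ∈ Subgroup.zpowers (x : G)) : z ∈ Subgroup.zpowers (y : G) := by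
  obtain ⟨W⟩ := h
  induction W with
  | nil => exact hz
  | @cons u v _ hadj _ ih =>
    apply ih
    have hadj' : (u : G) ≠ v ∧ ((u : G) ∈ Subgroup.zpowers (v : G) ∨
      (v : G) ∈ Subgroup.zpowers (u : G)) := hadj
    rcases hadj'.2 with h | h
    · exact Subgroup.zpowers_le.2 h hz
    · obtain ⟨w, hw, ow⟩ := aux_ex hp hG v.2
      exact Subgroup.zpowers_le.2 hw (aux_gen hp (Subgroup.zpowers_le.2 h hw) hz ow oz)

/-- In a nontrivial finite `p`-group `G`, every connected component of
the proper power graph `𝒢*(G)` contains exactly `p − 1` elements of order `p`. -/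
theorem stmt18 {G : Type*} [Group G] [Finite G] [Nontrivial G] (p : ℕ) (hp : p.Prime)
    (hG : ∃ m : ℕ, Nat.card G = p ^ m) :
    ∀ C : (properPowerGraph G).ConnectedComponent,
      {y : {g : G | g ≠ 1} | (properPowerGraph G).connectedComponentMk y = C
        ∧ orderOf (y : G) = p}.ncard = p - 1 := by
  intro C
  induction C using SimpleGraph.ConnectedComponent.ind with | _ x => ?_
  obtain ⟨w, hw, ow⟩ := aux_ex hp hG x.2
  have hwG : ∀ u : {g : G | g ≠ 1}, ∀ v : {g : G | g ≠ 1}, (u : G) ∈ Subgroup.zpowers (v : G) →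
      (properPowerGraph G).Reachable u v := by
    intro u v huv
    by_cases e : u = v
    · rw [e]
    · apply SimpleGraph.Adj.reachable
      exact ⟨fun h => e (Subtype.ext h), Or.inl huv⟩
  rw [← Set.ncard_image_of_injective _ Subtype.val_injective]
  have e : (Subtype.val '' {y : {g : G | g ≠ 1} | (properPowerGraph G).connectedComponentMk y =
      (properPowerGraph G).connectedComponentMk x ∧ orderOf (y : G) = p}) =
      (Subgroup.zpowers w : Set G) \ {1} := by
    ext z
    constructor
    · rintro ⟨y, ⟨hy, oy⟩, rfl⟩
      refine ⟨?_, y.2⟩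
      have hr := SimpleGraph.ConnectedComponent.exact hy
      exact aux_gen hp hw (aux_reach hp hG oy hr (Subgroup.mem_zpowers _)) ow oy
    · rintro ⟨hz, hz1⟩
      refine ⟨⟨z, hz1⟩, ⟨?_, ?_⟩, rfl⟩
      · exact SimpleGraph.ConnectedComponent.sound (hwG _ _ (Subgroup.zpowers_le.2 hw hz))
      · have : orderOf z ∣ p := ow ▸ orderOf_dvd_of_mem_zpowers hz
        rcases (Nat.dvd_prime hp).1 this with h | h
        · exact absurd (orderOf_eq_one_iff.1 h) hz1
        · exact h
  rw [e, Set.ncard_sdiff_singleton_of_mem (one_mem (Subgroup.zpowers w)), ← Nat.card_coe_set_eq]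
  congr 1
  exact (Nat.card_zpowers w).trans ow
end

section
/- Let p be a prime and G an abelian p-group isomorphic to a direct product H_1 × H_2 × ⋯ × H_r of r nontrivial cyclic p-groups. Then the number of connected components of the proper power graph 𝒢*(G) is p^{r−1} + p^{r−2} + ⋯ + p + 1 = (p^r − 1)/(p − 1). -/
open SimpleGraph

theorem aux_card_cyc (p : ℕ) (hp : p.Prime) {C : Type*} [Group C] [Finite C] [IsCyclic C]
    (hd : p ∣ Nat.card C) : Nat.card {g : C // g ^ p = 1} = p := by
  classical
  have := Fintype.ofFinite C
  have : Fact p.Prime := ⟨hp⟩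
  apply le_antisymm
  · have := IsCyclic.card_pow_eq_one_le (α := C) hp.pos
    rw [Nat.card_eq_fintype_card, Fintype.card_subtype]
    exact this
  · obtain ⟨g, hg⟩ := exists_prime_orderOf_dvd_card' (G := C) p hd
    have h1 : Nat.card (Subgroup.zpowers g) = p := by rw [Nat.card_zpowers, hg]
    conv_lhs => rw [← h1]
    refine Nat.card_le_card_of_injective
      (fun x : Subgroup.zpowers g => (⟨x.1, ?_⟩ : {g : C // g ^ p = 1})) ?_
    · obtain ⟨x, k, rfl⟩ := x
      have : g ^ p = 1 := by rw [← hg]; exact pow_orderOf_eq_one g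
      simp only
      rw [← zpow_natCast, ← zpow_mul, mul_comm, zpow_mul, zpow_natCast, this, one_zpow]
    · intro x y hxy
      apply Subtype.ext
      simpa using hxy

/-- The part of `⟨x⟩` killed by `p`. -/
def auxF (p : ℕ) {G : Type*} [CommGroup G] (x : G) : Subgroup G :=
  Subgroup.zpowers x ⊓ (powMonoidHom p : G →* G).ker

theorem mem_auxF (p : ℕ) {G : Type*} [CommGroup G] (x g : G) :
    g ∈ auxF p x ↔ g ∈ Subgroup.zpowers x ∧ g ^ p = 1 := by
  simp [auxF, Subgroup.mem_inf, MonoidHom.mem_ker]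

theorem card_auxF (p : ℕ) (hp : p.Prime) {G : Type*} [CommGroup G] [Finite G]
    (hG : IsPGroup p G) (x : G) (hx : x ≠ 1) : Nat.card (auxF p x) = p := by
  have : Fact p.Prime := ⟨hp⟩
  have hd : p ∣ Nat.card (Subgroup.zpowers x) := by
    rw [Nat.card_zpowers]
    obtain ⟨k, hk⟩ := IsPGroup.iff_orderOf.1 hG x
    rcases k with _ | k
    · simp at hk; exact absurd hk hx
    · rw [hk]; exact dvd_pow_self p (by omega)
  refine Eq.trans ?_ (aux_card_cyc p hp hd)
  refine Nat.card_congr ⟨fun g => ⟨⟨g.1, ((mem_auxF p x g.1).1 g.2).1⟩, ?_⟩,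
    fun g => ⟨g.1.1, (mem_auxF p x _).2 ⟨g.1.2, ?_⟩⟩, fun g => rfl, fun g => rfl⟩
  · exact Subtype.ext ((mem_auxF p x g.1).1 g.2).2
  · exact congrArg Subtype.val g.2

theorem auxF_eq (p : ℕ) (hp : p.Prime) {G : Type*} [CommGroup G] [Finite G]
    (hG : IsPGroup p G) (x y : G) (hx : x ≠ 1) (hy : y ≠ 1) (h : x ∈ Subgroup.zpowers y) :
    auxF p x = auxF p y := by
  apply Subgroup.eq_of_le_of_card_ge
  · exact inf_le_inf_right _ (by simpa using h)
  · rw [card_auxF p hp hG x hx, card_auxF p hp hG y hy]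

theorem aux_reach_of_mem {G : Type*} [CommGroup G] (x y : {g : G | g ≠ 1})
    (h : x.1 ∈ Subgroup.zpowers y.1) : (properPowerGraph G).Reachable x y := by
  by_cases hxy : x = y
  · subst hxy; rfl
  · apply SimpleGraph.Adj.reachable
    exact ⟨fun hh => hxy (Subtype.ext hh), Or.inl h⟩

theorem aux_reach_s19 (p : ℕ) (hp : p.Prime) {G : Type*} [CommGroup G] [Finite G]
    (hG : IsPGroup p G) (x y : {g : G | g ≠ 1}) :
    (properPowerGraph G).Reachable x y ↔ auxF p x.1 = auxF p y.1 := by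
  constructor
  · rintro ⟨w⟩
    induction w with
    | nil => rfl
    | @cons u v _ h _ ih =>
      rw [← ih]
      rcases h.2 with h | h
      · exact auxF_eq p hp hG u.1 v.1 u.2 v.2 h
      · exact (auxF_eq p hp hG v.1 u.1 v.2 u.2 h).symm
  · intro h
    have hc := card_auxF p hp hG x.1 x.2
    have hn : Nontrivial (auxF p x.1) := by
      rw [← Finite.one_lt_card_iff_nontrivial, hc]; exact hp.one_lt
    obtain ⟨g, hg⟩ := exists_ne (1 : auxF p x.1)
    have hg1 : g.1 ≠ 1 := fun hh => hg (Subtype.ext hh)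
    have hgx := ((mem_auxF p x.1 g.1).1 g.2).1
    have hgy := ((mem_auxF p y.1 g.1).1 (h ▸ g.2)).1
    exact (aux_reach_of_mem ⟨g.1, hg1⟩ x hgx).symm.trans (aux_reach_of_mem ⟨g.1, hg1⟩ y hgy)

theorem aux_card_ne {A : Type*} [Finite A] (a : A) :
    Nat.card {x : A // x ≠ a} = Nat.card A - 1 := by
  classical
  have := Fintype.ofFinite A
  simp [Nat.card_eq_fintype_card, Fintype.card_subtype_compl]

theorem aux_count (p : ℕ) (hp : p.Prime) {G : Type*} [CommGroup G] [Finite G]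
    (hG : IsPGroup p G) :
    Nat.card (properPowerGraph G).ConnectedComponent * (p - 1) =
      Nat.card {g : G // g ^ p = 1} - 1 := by
  classical
  have : Finite (properPowerGraph G).ConnectedComponent :=
    Quot.finite _
  have := Fintype.ofFinite (properPowerGraph G).ConnectedComponent
  let Ω := {t : {g : G // g ^ p = 1} // t ≠ ⟨1, one_pow p⟩}
  let f : Ω → (properPowerGraph G).ConnectedComponent := fun t =>
    (properPowerGraph G).connectedComponentMk ⟨t.1.1, fun h => t.2 (Subtype.ext h)⟩
  rw [← aux_card_ne (⟨1, one_pow p⟩ : {g : G // g ^ p = 1}),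
    ← Nat.card_congr (Equiv.sigmaFiberEquiv f), Nat.card_sigma]
  have key : ∀ c, Nat.card {t : Ω // f t = c} = p - 1 := by
    intro c
    induction c using SimpleGraph.ConnectedComponent.ind with
    | h x =>
    rw [← card_auxF p hp hG x.1 x.2, ← aux_card_ne (1 : auxF p x.1)]
    refine Nat.card_congr ⟨fun t => ⟨⟨t.1.1.1, ?_⟩, ?_⟩,
      fun t => ⟨⟨⟨t.1.1, ((mem_auxF p x.1 t.1.1).1 t.1.2).2⟩, ?_⟩, ?_⟩, fun t => rfl, fun t => rfl⟩
    · have h := (aux_reach_s19 p hp hG _ _).1 (SimpleGraph.ConnectedComponent.exact t.2)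
      rw [← h, mem_auxF]
      exact ⟨Subgroup.mem_zpowers _, t.1.1.2⟩
    · intro h
      have h' := congrArg Subtype.val h
      exact t.1.2 (Subtype.ext h')
    · intro h
      have h' := congrArg Subtype.val h
      exact t.2 (Subtype.ext h')
    · exact SimpleGraph.ConnectedComponent.sound
        (aux_reach_of_mem _ _ ((mem_auxF p x.1 t.1.1).1 t.1.2).1)
  simp [key, Nat.card_eq_fintype_card]

/-- If `G` is an abelian `p`-group isomorphic to a direct product of
`r` nontrivial cyclic `p`-groups, then the number of connected components of the
proper power graph `𝒢*(G)` is `p^{r−1} + ⋯ + p + 1 = (p^r − 1)/(p − 1)`. -/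
theorem stmt19 (p : ℕ) (hp : p.Prime) (r : ℕ)
    {G : Type*} [CommGroup G] [Finite G]
    (H : Fin r → Type*) [∀ i, Group (H i)] [∀ i, Finite (H i)]
    (hcyc : ∀ i, IsCyclic (H i)) (hnt : ∀ i, Nontrivial (H i))
    (hpg : ∀ i, ∃ m : ℕ, Nat.card (H i) = p ^ m)
    (e : G ≃* (∀ i, H i)) :
    Nat.card (properPowerGraph G).ConnectedComponent = ∑ i ∈ Finset.range r, p ^ i ∧
    ∑ i ∈ Finset.range r, p ^ i = (p ^ r - 1) / (p - 1) := by
  have hgs := Nat.geomSum_eq hp.two_le r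
  refine ⟨?_, hgs⟩
  have hG : IsPGroup p G := by
    choose m hm using hpg
    refine IsPGroup.of_card (n := ∑ i, m i) ?_
    rw [Nat.card_congr e.toEquiv, Nat.card_pi, ← Finset.prod_pow_eq_pow_sum]
    exact Finset.prod_congr rfl fun i _ => hm i
  have hΩ : Nat.card {g : G // g ^ p = 1} = p ^ r := by
    have e1 : {g : G // g ^ p = 1} ≃ ∀ i, {h : H i // h ^ p = 1} :=
      (e.toEquiv.subtypeEquiv (q := fun f => ∀ i, f i ^ p = 1) (fun g => by
        have : g ^ p = 1 ↔ (e g) ^ p = 1 := by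
          rw [← map_pow, EmbeddingLike.map_eq_one_iff]
        rw [this, funext_iff]; rfl)).trans
      (Equiv.subtypePiEquivPi (p := fun i (h : H i) => h ^ p = 1))
    rw [Nat.card_congr e1, Nat.card_pi]
    have : ∀ i, Nat.card {h : H i // h ^ p = 1} = p := by
      intro i
      have := hcyc i
      apply aux_card_cyc p hp
      obtain ⟨m, hm⟩ := hpg i
      have h1 : 1 < Nat.card (H i) := Finite.one_lt_card_iff_nontrivial.2 (hnt i)
      rcases m with _ | m
      · simp [hm] at h1
      · rw [hm]; exact dvd_pow_self p (by omega)
    simp [this]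
  have hc := aux_count p hp hG
  rw [hΩ] at hc
  rw [hgs, ← hc, Nat.mul_div_cancel _ (by have := hp.two_le; omega)]
end
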